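/- Let C be a finite category in which every full subcategory admits both a weighting and a coweighting (so every set S of objects has an Euler characteristic χ(S)), let Q be a finite poset, and let F : ob C → Q be measurable (the preimage of every upper set of Q is a filter of C and the preimage of every lower set of Q is an ideal of C). For each set S of objects of C let I^C_S be a ℚ-linear map from functions ob C → ℚ to ℚ with I^C_S(1_T) = χ(T) for every filter T of the full subcategory on S, and let I^Q be a ℚ-linear map from functions Q → ℚ to ℚ with I^Q(1_A) = χ_Q(A) for every upper set A of Q. Define the pushforward F_*f : Q → ℚ by F_*f(d) = I^C_{F⁻¹({q ≤ d})}(f·1_{F⁻¹({q ≤ d})}). Then for every definable function f : ob C → ℚ, I^C_{ob C}(f) = I^Q(F_*f); that is, the Euler integration of f over C equals the Euler integration of the pushforward F_*f over Q (Fubini-type theorem). -/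

import Mathlib

open CategoryTheory
open scoped Classical

/-- A filter of a category: closed under targets of morphisms out of its members. -/
def CatFilter (C : Type*) [Category C] (S : Set C) : Prop :=
  ∀ x ∈ S, ∀ y : C, Nonempty (x ⟶ y) → y ∈ S

/-- An ideal of a category: closed under sources of morphisms into its members. -/
def CatIdeal (C : Type*) [Category C] (S : Set C) : Prop :=
  ∀ x ∈ S, ∀ y : C, Nonempty (y ⟶ x) → y ∈ S

/-- A filter of the full subcategory of `C` on a set `S` of objects. -/
def CatFilterIn (C : Type*) [Category C] (S T : Set C) : Prop :=
  T ⊆ S ∧ ∀ x ∈ T, ∀ y ∈ S, Nonempty (x ⟶ y) → y ∈ T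

/-- A weighting on a set `S` of objects of `C`. -/
def IsWeightingOn (C : Type*) [Category C] [Fintype C] [∀ a b : C, Fintype (a ⟶ b)]
    (S : Set C) (w : C → ℚ) : Prop :=
  ∀ a ∈ S, (∑ b : C, if b ∈ S then (Fintype.card (a ⟶ b) : ℚ) * w b else 0) = 1

/-- A coweighting on a set `S` of objects of `C`. -/
def IsCoweightingOn (C : Type*) [Category C] [Fintype C] [∀ a b : C, Fintype (a ⟶ b)]
    (S : Set C) (v : C → ℚ) : Prop :=
  ∀ b ∈ S, (∑ a : C, if a ∈ S then v a * (Fintype.card (a ⟶ b) : ℚ) else 0) = 1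

/-- The weighting of a subset `S` of a finite poset. -/
def IsPosetWeighting (Q : Type*) [PartialOrder Q] [Fintype Q]
    (S : Set Q) (w : Q → ℚ) : Prop :=
  (∀ x : Q, x ∉ S → w x = 0) ∧
  ∀ a ∈ S, (∑ b : Q, if b ∈ S ∧ a ≤ b then w b else 0) = 1

/-- A function on objects is definable if it takes equal values on reflexible pairs. -/
def Definable (C : Type*) [Category C] (f : C → ℚ) : Prop :=
  ∀ x y : C, Nonempty (x ⟶ y) → Nonempty (y ⟶ x) → f x = f y

/-- The sum of a coweighting on `S` is the sum of any weighting on `S`. -/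
theorem IsCoweightingOn.sum_eq {C : Type*} [Category C] [Fintype C]
    [∀ a b : C, Fintype (a ⟶ b)] {S : Set C} {v w : C → ℚ}
    (hv : IsCoweightingOn C S v) (hw : IsWeightingOn C S w) :
    (∑ a : C, if a ∈ S then v a else 0) = ∑ b : C, if b ∈ S then w b else 0 := by
  have h₁ : ∀ a : C, (if a ∈ S then v a else 0) = ∑ b : C,
      if a ∈ S ∧ b ∈ S then v a * (Fintype.card (a ⟶ b) : ℚ) * w b else 0 := by
    intro a
    by_cases ha : a ∈ S
    · simp only [ha, if_true, true_and]
      conv_lhs => rw [← mul_one (v a), ← hw a ha, Finset.mul_sum]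
      exact Finset.sum_congr rfl fun b _ => by split_ifs <;> ring
    · simp [ha]
  have h₂ : ∀ b : C, (if b ∈ S then w b else 0) = ∑ a : C,
      if a ∈ S ∧ b ∈ S then v a * (Fintype.card (a ⟶ b) : ℚ) * w b else 0 := by
    intro b
    by_cases hb : b ∈ S
    · simp only [hb, if_true, and_true]
      conv_lhs => rw [← one_mul (w b), ← hv b hb, Finset.sum_mul]
      exact Finset.sum_congr rfl fun a _ => by split_ifs <;> ring
    · simp [hb]
  simp_rw [h₁, h₂]
  exact Finset.sum_comm

/-- A coweighting on `T` restricts to a coweighting on the intersection with an ideal. -/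
theorem IsCoweightingOn.inter_ideal {C : Type*} [Category C] [Fintype C]
    [∀ a b : C, Fintype (a ⟶ b)] {T I : Set C} {v : C → ℚ}
    (hv : IsCoweightingOn C T v) (hI : CatIdeal C I) : IsCoweightingOn C (T ∩ I) v := by
  intro b hb
  rw [← hv b hb.1]
  refine Finset.sum_congr rfl fun a _ => ?_
  by_cases hab : Nonempty (a ⟶ b)
  · simp [hI b hb.2 a hab]
  · rw [not_nonempty_iff] at hab
    simp

/-- Linear functionals agreeing on indicators of filters agree on definable functions. -/
theorem Definable.linearMap_eq {C : Type*} [Category C] [Fintype C]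
    (L M : (C → ℚ) →ₗ[ℚ] ℚ)
    (h : ∀ T : Set C, CatFilter C T →
      L (fun x => if x ∈ T then 1 else 0) = M (fun x => if x ∈ T then 1 else 0))
    {f : C → ℚ} (hf : Definable C f) : L f = M f := by
  let U : C → Set C := fun x => {y | Nonempty (x ⟶ y)}
  let V : C → Set C := fun x => {y | Nonempty (x ⟶ y) ∧ ¬ Nonempty (y ⟶ x)}
  let ind : Set C → C → ℚ := fun T x => if x ∈ T then 1 else 0
  let r : C → C → Prop := fun x y => Nonempty (x ⟶ y) ∧ Nonempty (y ⟶ x)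
  let n : C → ℚ := fun x => ∑ y : C, if r x y then 1 else 0
  have hU : ∀ x, CatFilter C (U x) := fun x y ⟨g⟩ z ⟨k⟩ => ⟨g ≫ k⟩
  have hV : ∀ x, CatFilter C (V x) := fun x y ⟨⟨g⟩, hy⟩ z ⟨k⟩ =>
    ⟨⟨g ≫ k⟩, fun ⟨l⟩ => hy ⟨k ≫ l⟩⟩
  have hn : ∀ x, n x ≠ 0 := by
    intro x
    have : (0 : ℚ) < n x := Finset.sum_pos' (fun y _ => by positivity)
      ⟨x, Finset.mem_univ x, by simp [r, show Nonempty (x ⟶ x) from ⟨𝟙 x⟩]⟩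
    exact this.ne'
  have hr : ∀ x y, r x y → f x / n x = f y / n y := by
    rintro x y ⟨⟨g⟩, ⟨k⟩⟩
    have hxy : n x = n y := by
      refine Finset.sum_congr rfl fun z _ => if_congr ?_ rfl rfl
      exact ⟨fun ⟨⟨a⟩, ⟨b⟩⟩ => ⟨⟨k ≫ a⟩, ⟨b ≫ g⟩⟩, fun ⟨⟨a⟩, ⟨b⟩⟩ => ⟨⟨g ≫ a⟩, ⟨b ≫ k⟩⟩⟩
    rw [hf x y ⟨g⟩ ⟨k⟩, hxy]
  have key : f = ∑ x : C, (f x / n x) • (ind (U x) - ind (V x)) := by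
    funext y
    have hterm : ∀ x, ((f x / n x) • (ind (U x) - ind (V x))) y =
        f y / n y * if r y x then 1 else 0 := by
      intro x
      by_cases h₁ : Nonempty (x ⟶ y) <;> by_cases h₂ : Nonempty (y ⟶ x)
      · simp [ind, U, V, r, h₁, h₂, -not_nonempty_iff, hr x y ⟨h₁, h₂⟩]
      · simp [ind, U, V, r, h₁, h₂, -not_nonempty_iff]
      · simp [ind, U, V, r, h₁, h₂, -not_nonempty_iff]
      · simp [ind, U, V, r, h₁, h₂, -not_nonempty_iff]
    rw [Finset.sum_apply, Finset.sum_congr rfl fun x _ => hterm x, ← Finset.mul_sum]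
    exact (div_mul_cancel₀ _ (hn y)).symm
  rw [key]
  simp only [map_sum, map_smul, map_sub]
  refine Finset.sum_congr rfl fun x _ => ?_
  rw [show L (ind (U x)) = M (ind (U x)) from h _ (hU x),
    show L (ind (V x)) = M (ind (V x)) from h _ (hV x)]

/-- The clipping of functions to a set, as a linear map. -/
noncomputable def clipLinearMap {C : Type*} (S : Set C) : (C → ℚ) →ₗ[ℚ] (C → ℚ) where
  toFun f x := if x ∈ S then f x else 0
  map_add' f g := by
    funext x
    by_cases h : x ∈ S <;> simp [h]
  map_smul' c f := by
    funext x
    by_cases h : x ∈ S <;> simp [h]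

/-- **Fubini.** The Euler integration of a definable function `f`
over a measurable category `C` equals the Euler integration over a finite poset
`Q` of the pushforward of `f` along a measurable map `F : C → Q`. -/
theorem euler_integration_fubini
    (C : Type*) [Category C] [Fintype C] [∀ a b : C, Fintype (a ⟶ b)]
    (Q : Type*) [PartialOrder Q] [Fintype Q]
    (χ : Set C → ℚ)
    (hχ : ∀ S : Set C,
      ∃ w v : C → ℚ, IsWeightingOn C S w ∧ IsCoweightingOn C S v ∧
        χ S = ∑ b : C, if b ∈ S then w b else 0)
    (χQ : Set Q → ℚ)
    (hχQ : ∀ S : Set Q,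
      ∃ w : Q → ℚ, IsPosetWeighting Q S w ∧ χQ S = ∑ b : Q, if b ∈ S then w b else 0)
    (F : C → Q)
    (hFup : ∀ S : Set Q, IsUpperSet S → CatFilter C (F ⁻¹' S))
    (hFlow : ∀ S : Set Q, IsLowerSet S → CatIdeal C (F ⁻¹' S))
    (IC : Set C → ((C → ℚ) →ₗ[ℚ] ℚ))
    (hIC : ∀ S T : Set C, CatFilterIn C S T →
      IC S (fun x => if x ∈ T then 1 else 0) = χ T)
    (IQ : (Q → ℚ) →ₗ[ℚ] ℚ)
    (hIQ : ∀ A : Set Q, IsUpperSet A →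
      IQ (fun d => if d ∈ A then 1 else 0) = χQ A)
    (f : C → ℚ) (hf : Definable C f) :
    IC Set.univ f =
      IQ (fun d => IC (F ⁻¹' {q : Q | q ≤ d})
        (fun x => if x ∈ F ⁻¹' {q : Q | q ≤ d} then f x else 0)) := by
  have hIdeal : ∀ d : Q, CatIdeal C (F ⁻¹' {q : Q | q ≤ d}) := fun d =>
    hFlow _ (isLowerSet_Iic d)
  have hIci : ∀ a : Q, IQ (fun d => if a ≤ d then 1 else 0) = 1 := by
    intro a
    obtain ⟨w, ⟨-, hw⟩, hsum⟩ := hχQ (Set.Ici a)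
    have h := hIQ (Set.Ici a) (isUpperSet_Ici a)
    simp only [Set.mem_Ici] at h hsum
    rw [h, hsum, ← hw a Set.self_mem_Ici]
    simp
  have hcow : ∀ (S : Set C) (v : C → ℚ), IsCoweightingOn C S v →
      χ S = ∑ x : C, if x ∈ S then v x else 0 := by
    intro S v hv
    obtain ⟨w, -, hw, -, hS⟩ := hχ S
    rw [hS, hv.sum_eq hw]
  refine hf.linearMap_eq (IC Set.univ)
    (IQ ∘ₗ LinearMap.pi fun d => IC (F ⁻¹' {q : Q | q ≤ d}) ∘ₗ
      clipLinearMap (F ⁻¹' {q : Q | q ≤ d})) fun T hT => ?_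
  rw [hIC Set.univ T ⟨Set.subset_univ T, fun x hx y _ => hT x hx y⟩]
  obtain ⟨-, v, -, hv, -⟩ := hχ T
  have hpush : (LinearMap.pi fun d => IC (F ⁻¹' {q : Q | q ≤ d}) ∘ₗ
      clipLinearMap (F ⁻¹' {q : Q | q ≤ d})) (fun x => if x ∈ T then (1 : ℚ) else 0) =
      ∑ x : C, (if x ∈ T then v x else 0) • fun d => if F x ≤ d then (1 : ℚ) else 0 := by
    funext d
    obtain ⟨R, hR⟩ : ∃ R, R = T ∩ F ⁻¹' {q : Q | q ≤ d} := ⟨_, rfl⟩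
    have hclip : clipLinearMap (F ⁻¹' {q : Q | q ≤ d}) (fun x => if x ∈ T then (1 : ℚ) else 0) =
        fun x => if x ∈ R then 1 else 0 := by
      funext x
      by_cases h₁ : x ∈ T <;> by_cases h₂ : F x ≤ d <;> simp [clipLinearMap, hR, h₁, h₂]
    rw [LinearMap.pi_apply, LinearMap.comp_apply, hclip,
      hIC _ R (hR ▸ ⟨Set.inter_subset_right, fun x hx y hy hxy => ⟨hT x hx.1 y hxy, hy⟩⟩),
      hcow R v (hR ▸ hv.inter_ideal (hIdeal d)), Finset.sum_apply]
    refine Finset.sum_congr rfl fun x _ => ?_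
    by_cases h₁ : x ∈ T <;> by_cases h₂ : F x ≤ d <;> simp [hR, h₁, h₂]
  rw [LinearMap.comp_apply, hpush, hcow T v hv]
  simp only [map_sum, map_smul, hIci, smul_eq_mul, mul_one]
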